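/- Assume conditions (1.2) and (1.3), let u, v be a principal fundamental system of solutions of (r z')' = q z, and suppose r₀ := sup_{x∈ℝ} r(x) < ∞. If h₀ := sup_{x∈ℝ} h(x) < ∞, then for every p ∈ (1,∞) the Green operator G is bounded on L_p(ℝ); if moreover h(x) → 0 as |x| → ∞, then G : L_p(ℝ) → L_p(ℝ) is compact for every p ∈ (1,∞). -/

import Mathlib

open MeasureTheory Filter Topology
open scoped ENNReal RealInnerProductSpace

noncomputable section

/-- Conditions (1.2): `r, q` measurable, `r > 0`, `q ≥ 0`, with `1/r` and `q`
locally Lebesgue integrable on `ℝ`. -/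
def Cond12 (r q : ℝ → ℝ) : Prop :=
  Measurable r ∧ Measurable q ∧ (∀ x, 0 < r x) ∧ (∀ x, 0 ≤ q x) ∧
    LocallyIntegrable (fun t => 1 / r t) volume ∧ LocallyIntegrable q volume

/-- Condition (1.3): for every `x`,
`(∫_{x-d}^x dt/r(t)) · (∫_{x-d}^x q(t) dt) → ∞` as `|d| → ∞`. -/
def Cond13 (r q : ℝ → ℝ) : Prop :=
  ∀ x : ℝ, Tendsto (fun d : ℝ => (∫ t in x - d..x, 1 / r t) * (∫ t in x - d..x, q t))
    (cocompact ℝ) atTop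

/-- Condition (2.1): `∫_{-∞}^x q > 0` and `∫_x^∞ q > 0` for every `x`. -/
def Cond21 (q : ℝ → ℝ) : Prop :=
  ∀ x : ℝ, 0 < ∫⁻ t in Set.Iic x, ENNReal.ofReal (q t) ∧
    0 < ∫⁻ t in Set.Ici x, ENNReal.ofReal (q t)

/-- A principal fundamental system of solutions `u, v` (with a.e. derivatives
`u', v'`) of the equation `(r z')' = q z`:  `u, v, r u', r v'` are locally
absolutely continuous (expressed through the integral identities below),
`(r u')' = q u` and `(r v')' = q v` a.e., `u > 0`, `v > 0`, `v' ≥ 0`, `u' ≤ 0`,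
`r (v' u - u' v) ≡ 1`, `v/u → 0` at `-∞`, `u/v → 0` at `+∞`,
`∫_{-∞}^0 dt/(r u²) < ∞` and `∫_0^∞ dt/(r v²) < ∞`. -/
structure PFSS (r q u v u' v' : ℝ → ℝ) : Prop where
  u_pos : ∀ x, 0 < u x
  v_pos : ∀ x, 0 < v x
  u'_nonpos : ∀ x, u' x ≤ 0
  v'_nonneg : ∀ x, 0 ≤ v' x
  u'_intble : ∀ a b : ℝ, IntervalIntegrable u' volume a b
  v'_intble : ∀ a b : ℝ, IntervalIntegrable v' volume a b
  u_deriv : ∀ a b : ℝ, u b - u a = ∫ t in a..b, u' t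
  v_deriv : ∀ a b : ℝ, v b - v a = ∫ t in a..b, v' t
  ru'_deriv : ∀ a b : ℝ, r b * u' b - r a * u' a = ∫ t in a..b, q t * u t
  rv'_deriv : ∀ a b : ℝ, r b * v' b - r a * v' a = ∫ t in a..b, q t * v t
  wronskian : ∀ x, r x * (v' x * u x - u' x * v x) = 1
  ratio_bot : Tendsto (fun x => v x / u x) atBot (𝓝 0)
  ratio_top : Tendsto (fun x => u x / v x) atTop (𝓝 0)
  int_u : ∫⁻ t in Set.Iic (0:ℝ), ENNReal.ofReal (1 / (r t * u t ^ 2)) < ⊤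
  int_v : ∫⁻ t in Set.Ici (0:ℝ), ENNReal.ofReal (1 / (r t * v t ^ 2)) < ⊤

/-- The Green kernel `G(x,t) = u(x) v(t)` for `x ≥ t`, `u(t) v(x)` for `x ≤ t`. -/
def greenKernel (u v : ℝ → ℝ) (x t : ℝ) : ℝ :=
  if t ≤ x then u x * v t else u t * v x

/-- The space `L_p(ℝ)` (with respect to Lebesgue measure). -/
abbrev LpR (p : ℝ≥0∞) : Type := Lp ℝ p (volume : Measure ℝ)

/-- `G` is (a bounded realization on `L_p` of) the Green operator
`(G f)(x) = ∫_ℝ G(x,t) f(t) dt`. -/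
def IsGreenOp (u v : ℝ → ℝ) (p : ℝ≥0∞) [Fact (1 ≤ p)]
    (G : LpR p →L[ℝ] LpR p) : Prop :=
  ∀ f : LpR p,
    (G f : ℝ → ℝ) =ᵐ[volume] fun x => ∫ t, greenKernel u v x t * (f : ℝ → ℝ) t

/-- `d₁` solves `(∫_{x-d}^x dt/r)(∫_{x-d}^x q dt) = 1`, `d₁ > 0`. -/
def IsD1 (r q d₁ : ℝ → ℝ) : Prop :=
  ∀ x : ℝ, 0 < d₁ x ∧
    (∫ t in x - d₁ x..x, 1 / r t) * (∫ t in x - d₁ x..x, q t) = 1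

/-- `d₂` solves `(∫_x^{x+d} dt/r)(∫_x^{x+d} q dt) = 1`, `d₂ > 0`. -/
def IsD2 (r q d₂ : ℝ → ℝ) : Prop :=
  ∀ x : ℝ, 0 < d₂ x ∧
    (∫ t in x..x + d₂ x, 1 / r t) * (∫ t in x..x + d₂ x, q t) = 1

/-- `φ(x) = ∫_{x-d₁(x)}^x dt/r(t)`. -/
def phiF (r d₁ : ℝ → ℝ) (x : ℝ) : ℝ := ∫ t in x - d₁ x..x, 1 / r t

/-- `ψ(x) = ∫_x^{x+d₂(x)} dt/r(t)`. -/
def psiF (r d₂ : ℝ → ℝ) (x : ℝ) : ℝ := ∫ t in x..x + d₂ x, 1 / r t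

/-- `h(x) = φ(x)ψ(x)/(φ(x)+ψ(x))`. -/
def hF (r d₁ d₂ : ℝ → ℝ) (x : ℝ) : ℝ :=
  phiF r d₁ x * psiF r d₂ x / (phiF r d₁ x + psiF r d₂ x)

/-- `d` solves `∫_{x-d(x)}^{x+d(x)} dt/(r(t)h(t)) = 1`, `d > 0`. -/
def IsD (r h d : ℝ → ℝ) : Prop :=
  ∀ x : ℝ, 0 < d x ∧ (∫ t in x - d x..x + d x, 1 / (r t * h t)) = 1

/-- `s` solves `∫_{x-s(x)}^{x+s(x)} dt/(r(t)ρ(t)) = 1`, `s > 0`. -/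
def IsS (r ρ s : ℝ → ℝ) : Prop :=
  ∀ x : ℝ, 0 < s x ∧ (∫ t in x - s x..x + s x, 1 / (r t * ρ t)) = 1


lemma PFSS.continuous_u {r q u v u' v' : ℝ → ℝ} (H : PFSS r q u v u' v') : Continuous u := by
  have h := (intervalIntegral.continuous_primitive H.u'_intble 0).const_add (u 0)
  convert h using 2 with x
  linarith [H.u_deriv 0 x]

lemma PFSS.continuous_v {r q u v u' v' : ℝ → ℝ} (H : PFSS r q u v u' v') : Continuous v := by
  have h := (intervalIntegral.continuous_primitive H.v'_intble 0).const_add (v 0)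
  convert h using 2 with x
  linarith [H.v_deriv 0 x]

lemma PFSS.antitone_u {r q u v u' v' : ℝ → ℝ} (H : PFSS r q u v u' v') : Antitone u := by
  intro a b hab
  have h : 0 ≤ ∫ t in a..b, -u' t :=
    intervalIntegral.integral_nonneg hab fun t _ => neg_nonneg.2 (H.u'_nonpos t)
  rw [intervalIntegral.integral_neg] at h
  linarith [H.u_deriv a b]

lemma PFSS.monotone_v {r q u v u' v' : ℝ → ℝ} (H : PFSS r q u v u' v') : Monotone v := by
  intro a b hab
  have h : 0 ≤ ∫ t in a..b, v' t := intervalIntegral.integral_nonneg hab fun t _ => H.v'_nonneg t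
  linarith [H.v_deriv a b]

lemma PFSS.monotone_ru' {r q u v u' v' : ℝ → ℝ} (H : PFSS r q u v u' v')
    (hq : ∀ x, 0 ≤ q x) : Monotone fun x => r x * u' x := by
  intro a b hab
  have h : 0 ≤ ∫ t in a..b, q t * u t :=
    intervalIntegral.integral_nonneg hab fun t _ => mul_nonneg (hq t) (H.u_pos t).le
  simp only
  linarith [H.ru'_deriv a b]

lemma PFSS.monotone_rv' {r q u v u' v' : ℝ → ℝ} (H : PFSS r q u v u' v')
    (hq : ∀ x, 0 ≤ q x) : Monotone fun x => r x * v' x := by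
  intro a b hab
  have h : 0 ≤ ∫ t in a..b, q t * v t :=
    intervalIntegral.integral_nonneg hab fun t _ => mul_nonneg (hq t) (H.v_pos t).le
  simp only
  linarith [H.rv'_deriv a b]

/-- If `(∫_a^x dt/r) (∫_a^x q) = 1` then `v / (r v') ≤ 2 ∫_a^x dt/r` at `x`. -/
lemma PFSS.v_le {r q u v u' v' : ℝ → ℝ} (H : PFSS r q u v u' v') (h12 : Cond12 r q)
    {a x : ℝ} (hax : a ≤ x) (h1 : (∫ t in a..x, 1 / r t) * (∫ t in a..x, q t) = 1) :
    v x ≤ 2 * (r x * v' x) * ∫ t in a..x, 1 / r t := by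
  obtain ⟨-, -, hr, hq, hir, hiq⟩ := h12
  replace hir : ∀ a b, IntervalIntegrable (fun t => 1 / r t) volume a b := fun a b =>
    (hir.integrableOn_isCompact isCompact_uIcc).intervalIntegrable
  replace hiq : ∀ a b, IntervalIntegrable q volume a b := fun a b =>
    (hiq.integrableOn_isCompact isCompact_uIcc).intervalIntegrable
  set Φ := ∫ t in a..x, 1 / r t with hΦ
  set Q := ∫ t in a..x, q t with hQ
  set W := r x * v' x with hW
  have hW0 : 0 ≤ W := mul_nonneg (hr x).le (H.v'_nonneg x)
  have hΦ0 : 0 ≤ Φ := intervalIntegral.integral_nonneg hax fun t _ => (one_div_pos.2 (hr t)).le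
  have hv : ∀ t ∈ Set.Icc a x, v x - W * Φ ≤ v t := by
    intro t ht
    have h2 : v x - v t ≤ ∫ s in t..x, W * (1 / r s) := by
      rw [H.v_deriv]
      refine intervalIntegral.integral_mono_on ht.2 (H.v'_intble t x)
        ((hir t x).const_mul W) fun s hs => ?_
      rw [mul_one_div, le_div_iff₀ (hr s), mul_comm]
      exact H.monotone_rv' hq hs.2
    rw [intervalIntegral.integral_const_mul] at h2
    have h3 : ∫ s in t..x, 1 / r s ≤ Φ := by
      rw [hΦ, ← intervalIntegral.integral_add_adjacent_intervals
        (hir a t) (hir t x)]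
      have : 0 ≤ ∫ t in a..t, 1 / r t :=
        intervalIntegral.integral_nonneg ht.1 fun t _ => (one_div_pos.2 (hr t)).le
      linarith
    nlinarith [mul_le_mul_of_nonneg_left h3 hW0]
  have h4 : Q * (v x - W * Φ) ≤ W := by
    have h5 : ∫ t in a..x, q t * (v x - W * Φ) ≤ ∫ t in a..x, q t * v t :=
      intervalIntegral.integral_mono_on hax ((hiq a x).mul_const _)
        ((hiq a x).mul_continuousOn H.continuous_v.continuousOn)
        fun t ht => mul_le_mul_of_nonneg_left (hv t ht) (hq t)
    rw [intervalIntegral.integral_mul_const] at h5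
    linarith [H.rv'_deriv a x, mul_nonneg (hr a).le (H.v'_nonneg a)]
  have h6 := mul_le_mul_of_nonneg_left h4 hΦ0
  rw [← mul_assoc, h1] at h6
  linarith

/-- If `(∫_x^b dt/r) (∫_x^b q) = 1` then `u / (-r u') ≤ 2 ∫_x^b dt/r` at `x`. -/
lemma PFSS.u_le {r q u v u' v' : ℝ → ℝ} (H : PFSS r q u v u' v') (h12 : Cond12 r q)
    {x b : ℝ} (hxb : x ≤ b) (h1 : (∫ t in x..b, 1 / r t) * (∫ t in x..b, q t) = 1) :
    u x ≤ 2 * -(r x * u' x) * ∫ t in x..b, 1 / r t := by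
  obtain ⟨-, -, hr, hq, hir, hiq⟩ := h12
  replace hir : ∀ a b, IntervalIntegrable (fun t => 1 / r t) volume a b := fun a b =>
    (hir.integrableOn_isCompact isCompact_uIcc).intervalIntegrable
  replace hiq : ∀ a b, IntervalIntegrable q volume a b := fun a b =>
    (hiq.integrableOn_isCompact isCompact_uIcc).intervalIntegrable
  set Ψ := ∫ t in x..b, 1 / r t with hΨ
  set Q := ∫ t in x..b, q t with hQ
  set W := -(r x * u' x) with hW
  have hW0 : 0 ≤ W := by
    have := mul_nonpos_of_nonneg_of_nonpos (hr x).le (H.u'_nonpos x)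
    linarith
  have hΨ0 : 0 ≤ Ψ := intervalIntegral.integral_nonneg hxb fun t _ => (one_div_pos.2 (hr t)).le
  have hu : ∀ t ∈ Set.Icc x b, u x - W * Ψ ≤ u t := by
    intro t ht
    have h2 : ∫ s in x..t, -u' s ≤ ∫ s in x..t, W * (1 / r s) := by
      refine intervalIntegral.integral_mono_on ht.1 (H.u'_intble x t).neg
        ((hir x t).const_mul W) fun s hs => ?_
      rw [mul_one_div, le_div_iff₀ (hr s), mul_comm]
      have := H.monotone_ru' hq hs.1
      simp only at this
      linarith
    rw [intervalIntegral.integral_const_mul, intervalIntegral.integral_neg, ← H.u_deriv] at h2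
    have h3 : ∫ s in x..t, 1 / r s ≤ Ψ := by
      rw [hΨ, ← intervalIntegral.integral_add_adjacent_intervals
        (hir x t) (hir t b)]
      have : 0 ≤ ∫ t in t..b, 1 / r t :=
        intervalIntegral.integral_nonneg ht.2 fun t _ => (one_div_pos.2 (hr t)).le
      linarith
    nlinarith [mul_le_mul_of_nonneg_left h3 hW0]
  have h4 : Q * (u x - W * Ψ) ≤ W := by
    have h5 : ∫ t in x..b, q t * (u x - W * Ψ) ≤ ∫ t in x..b, q t * u t :=
      intervalIntegral.integral_mono_on hxb ((hiq x b).mul_const _)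
        ((hiq x b).mul_continuousOn H.continuous_u.continuousOn)
        fun t ht => mul_le_mul_of_nonneg_left (hu t ht) (hq t)
    rw [intervalIntegral.integral_mul_const] at h5
    linarith [H.ru'_deriv x b, mul_nonpos_of_nonneg_of_nonpos (hr b).le (H.u'_nonpos b)]
  have h6 := mul_le_mul_of_nonneg_left h4 hΨ0
  rw [← mul_assoc, h1] at h6
  linarith

/-- The upper Otelbaev inequality `u v ≤ 2 h`. -/
lemma PFSS.u_mul_v_le {r q u v u' v' d₁ d₂ : ℝ → ℝ} (H : PFSS r q u v u' v')
    (h12 : Cond12 r q) (hd₁ : IsD1 r q d₁) (hd₂ : IsD2 r q d₂) (x : ℝ) :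
    u x * v x ≤ 2 * hF r d₁ d₂ x := by
  have hv : v x ≤ 2 * (r x * v' x) * phiF r d₁ x :=
    H.v_le h12 (by linarith [(hd₁ x).1]) (hd₁ x).2
  have hu : u x ≤ 2 * -(r x * u' x) * psiF r d₂ x :=
    H.u_le h12 (by linarith [(hd₂ x).1]) (hd₂ x).2
  have hΦ : 0 ≤ phiF r d₁ x := intervalIntegral.integral_nonneg (by linarith [(hd₁ x).1])
    fun t _ => (one_div_pos.2 (h12.2.2.1 t)).le
  have hΨ : 0 ≤ psiF r d₂ x := intervalIntegral.integral_nonneg (by linarith [(hd₂ x).1])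
    fun t _ => (one_div_pos.2 (h12.2.2.1 t)).le
  have hΦ' : phiF r d₁ x ≠ 0 := left_ne_zero_of_mul_eq_one (hd₁ x).2
  have hΨ' : psiF r d₂ x ≠ 0 := left_ne_zero_of_mul_eq_one (hd₂ x).2
  replace hΦ := lt_of_le_of_ne hΦ hΦ'.symm
  replace hΨ := lt_of_le_of_ne hΨ hΨ'.symm
  have hw := H.wronskian x
  have h1 := mul_le_mul_of_nonneg_left hv (mul_nonneg (H.u_pos x).le hΨ.le)
  have h2 := mul_le_mul_of_nonneg_left hu (mul_nonneg (H.v_pos x).le hΦ.le)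
  rw [hF, mul_div_assoc', le_div_iff₀ (by positivity)]
  calc u x * v x * (phiF r d₁ x + psiF r d₂ x)
      ≤ 2 * (phiF r d₁ x * psiF r d₂ x) * (r x * (v' x * u x - u' x * v x)) := by linarith
    _ = 2 * (phiF r d₁ x * psiF r d₂ x) := by rw [hw, mul_one]

/-- `v / u` grows at least exponentially when `r` and `u v` are bounded. -/
lemma PFSS.log_ratio_ge {r q u v u' v' : ℝ → ℝ} (H : PFSS r q u v u' v')
    (hr : ∀ x, 0 < r x) {R B : ℝ} (hR : ∀ x, r x ≤ R) (hB : ∀ x, u x * v x ≤ B)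
    {s x : ℝ} (hsx : s ≤ x) :
    Real.log (v s / u s) + (R * B)⁻¹ * (x - s) ≤ Real.log (v x / u x) := by
  have hu := H.u_pos
  have hv := H.v_pos
  have hcont : Continuous fun x => -Real.log (v x / u x) :=
    ((H.continuous_v.div H.continuous_u fun x => (hu x).ne').log
      fun x => (div_pos (hv x) (hu x)).ne').neg
  have hR0 : 0 < R := (hr 0).trans_le (hR 0)
  have hB0 : 0 < B := (mul_pos (hu 0) (hv 0)).trans_le (hB 0)
  have key : ∀ a b, a < b → slope (fun x => -Real.log (v x / u x)) a b ≤ -(R * (u a * v b))⁻¹ := by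
    intro a b hab
    have h1 : 1 - (v b / v a)⁻¹ ≤ Real.log (v b / v a) :=
      Real.one_sub_inv_le_log_of_pos (div_pos (hv b) (hv a))
    have h2 : 1 - (u a / u b)⁻¹ ≤ Real.log (u a / u b) :=
      Real.one_sub_inv_le_log_of_pos (div_pos (hu a) (hu b))
    rw [Real.log_div (hv b).ne' (hv a).ne', inv_div] at h1
    rw [Real.log_div (hu a).ne' (hu b).ne', inv_div] at h2
    have hu' : IntervalIntegrable (fun t => -u' t) volume a b := (H.u'_intble a b).neg
    have h3 : ∫ _ in a..b, R⁻¹ ≤ ∫ t in a..b, (u a * v' t + v b * -u' t) := by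
      refine intervalIntegral.integral_mono_on hab.le intervalIntegrable_const
        (((H.v'_intble a b).const_mul _).add (hu'.const_mul _)) fun t ht => ?_
      have h4 : R⁻¹ ≤ (r t)⁻¹ := inv_anti₀ (hr t) (hR t)
      have h5 : v' t * u t - u' t * v t = (r t)⁻¹ := eq_inv_of_mul_eq_one_right (H.wronskian t)
      have h6 := mul_le_mul_of_nonneg_right (H.antitone_u ht.1) (H.v'_nonneg t)
      have h7 := mul_le_mul_of_nonneg_right (H.monotone_v ht.2) (neg_nonneg.2 (H.u'_nonpos t))
      linarith
    rw [intervalIntegral.integral_add ((H.v'_intble a b).const_mul _)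
      (hu'.const_mul _), intervalIntegral.integral_const_mul,
      intervalIntegral.integral_const_mul, intervalIntegral.integral_neg, ← H.v_deriv,
      ← H.u_deriv, intervalIntegral.integral_const, smul_eq_mul] at h3
    rw [slope_def_field, div_le_iff₀ (sub_pos.2 hab), Real.log_div (hv b).ne' (hu b).ne',
      Real.log_div (hv a).ne' (hu a).ne']
    have h8 : (R * (u a * v b))⁻¹ * (b - a) ≤ (1 - v a / v b) + (1 - u b / u a) := by
      have e1 : (R * (u a * v b))⁻¹ * (b - a) = (b - a) * R⁻¹ / (u a * v b) := by
        have := (hu a).ne'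
        have := (hv b).ne'
        field_simp
      have e2 : (1 - v a / v b) + (1 - u b / u a)
          = (u a * (v b - v a) + v b * -(u b - u a)) / (u a * v b) := by
        have := (hu a).ne'
        have := (hv b).ne'
        field_simp
        ring
      rw [e1, e2]
      exact div_le_div_of_nonneg_right h3 (mul_pos (hu a) (hv b)).le
    linarith
  have main := image_le_of_liminf_slope_right_le_deriv_boundary
    (f := fun x => -Real.log (v x / u x)) (a := s) (b := x) hcont.continuousOn
    (B := fun y => -Real.log (v s / u s) + -(R * B)⁻¹ * (y - s)) (B' := fun _ => -(R * B)⁻¹)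
    (by simp) (by fun_prop)
    (fun y _ => by
      simpa using ((((hasDerivAt_id y).sub_const s).const_mul (-(R * B)⁻¹)).const_add
        (-Real.log (v s / u s))).hasDerivWithinAt)
    (fun y _ ρ hρ => by
      apply Eventually.frequently
      have hlim : Tendsto (fun z => -(R * (u y * v z))⁻¹) (𝓝[>] y) (𝓝 (-(R * (u y * v y))⁻¹)) := by
        refine Tendsto.mono_left ?_ nhdsWithin_le_nhds
        exact ((((H.continuous_v.tendsto y).const_mul (u y)).const_mul R).inv₀
          (mul_pos hR0 (mul_pos (hu y) (hv y))).ne').neg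
      have hlt : -(R * (u y * v y))⁻¹ < ρ := by
        refine lt_of_le_of_lt (neg_le_neg ?_) hρ
        exact inv_anti₀ (mul_pos hR0 (mul_pos (hu y) (hv y)))
          (mul_le_mul_of_nonneg_left (hB y) hR0.le)
      filter_upwards [hlim.eventually_lt_const hlt, self_mem_nhdsWithin] with z hz hyz
      exact (key y z hyz).trans_lt hz)
    (Set.right_mem_Icc.2 hsx)
  linarith

lemma greenKernel_symm (u v : ℝ → ℝ) (x t : ℝ) : greenKernel u v x t = greenKernel u v t x := by
  rcases lt_trichotomy t x with h | h | h
  · simp [greenKernel, h.le, not_le.2 h]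
  · simp [h]
  · simp [greenKernel, h.le, not_le.2 h]

lemma PFSS.greenKernel_pos {r q u v u' v' : ℝ → ℝ} (H : PFSS r q u v u' v') (x t : ℝ) :
    0 < greenKernel u v x t := by
  unfold greenKernel
  split_ifs
  exacts [mul_pos (H.u_pos x) (H.v_pos t), mul_pos (H.u_pos t) (H.v_pos x)]

/-- Exponential off-diagonal decay of the squared Green kernel. -/
lemma PFSS.greenKernel_sq_le {r q u v u' v' : ℝ → ℝ} (H : PFSS r q u v u' v')
    (hr : ∀ x, 0 < r x) {R B : ℝ} (hR : ∀ x, r x ≤ R) (hB : ∀ x, u x * v x ≤ B) (x t : ℝ) :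
    greenKernel u v x t ^ 2
      ≤ (u x * v x) * (u t * v t) * Real.exp (-((R * B)⁻¹ * |x - t|)) := by
  wlog htx : t ≤ x generalizing x t
  · rw [greenKernel_symm, abs_sub_comm, mul_comm (u x * v x)]
    exact this t x (le_of_not_ge htx)
  have h1 := H.log_ratio_ge hr hR hB htx
  have hu := H.u_pos
  have hv := H.v_pos
  have h2 : v t / u t / (v x / u x) ≤ Real.exp (-((R * B)⁻¹ * |x - t|)) := by
    rw [← Real.log_le_iff_le_exp (div_pos (div_pos (hv t) (hu t)) (div_pos (hv x) (hu x))),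
      Real.log_div (div_pos (hv t) (hu t)).ne' (div_pos (hv x) (hu x)).ne',
      abs_of_nonneg (sub_nonneg.2 htx)]
    linarith
  have h3 := mul_le_mul_of_nonneg_left h2
    (mul_pos (mul_pos (hu x) (hv x)) (mul_pos (hu t) (hv t))).le
  refine le_trans (le_of_eq ?_) h3
  have := (hu x).ne'
  have := (hu t).ne'
  have := (hv x).ne'
  simp only [greenKernel, htx, if_true]
  field_simp

/-- Where `u v` is small, so is the Green kernel, with uniform exponential decay. -/
lemma PFSS.greenKernel_le {r q u v u' v' : ℝ → ℝ} (H : PFSS r q u v u' v')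
    (hr : ∀ x, 0 < r x) {R B M : ℝ} (hR : ∀ x, r x ≤ R) (hB : ∀ x, u x * v x ≤ B) (hM : 0 ≤ M)
    {x : ℝ} (hx : u x * v x * B ≤ M ^ 2) (t : ℝ) :
    greenKernel u v x t ≤ M * Real.exp (-((2 * (R * B))⁻¹ * |x - t|)) := by
  refine le_of_sq_le_sq ?_ (by positivity)
  refine (H.greenKernel_sq_le hr hR hB x t).trans ?_
  rw [mul_pow, ← Real.exp_nat_mul]
  have e : ((2 : ℕ) : ℝ) * -((2 * (R * B))⁻¹ * |x - t|) = -((R * B)⁻¹ * |x - t|) := by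
    push_cast
    rw [mul_inv]
    ring
  rw [e]
  refine mul_le_mul_of_nonneg_right (le_trans ?_ hx) (Real.exp_pos _).le
  exact mul_le_mul_of_nonneg_left (hB t) (mul_pos (H.u_pos x) (H.v_pos x)).le

/-- Young's convolution inequality for `L¹ ∗ Lᵖ`, for nonnegative functions on the line. -/
lemma lintegral_rpow_convolution_le {k g : ℝ → ℝ≥0∞} (hk : Measurable k) (hg : Measurable g)
    {P : ℝ} (hP : 1 < P) :
    ∫⁻ x, (∫⁻ t, k (x - t) * g t) ^ P ≤ (∫⁻ s, k s) ^ P * ∫⁻ t, g t ^ P := by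
  have hP0 : 0 < P := by linarith
  have hPQ := Real.HolderConjugate.conjExponent hP
  set Q := P.conjExponent with hQ
  have hQ0 : 0 < Q := hPQ.symm.pos
  set A := ∫⁻ s, k s with hA
  have hkm : ∀ x : ℝ, Measurable fun t => k (x - t) := fun x => hk.comp (measurable_const_sub x)
  have hpt : ∀ x, (∫⁻ t, k (x - t) * g t) ^ P ≤ A ^ (P - 1) * ∫⁻ t, k (x - t) * g t ^ P := by
    intro x
    have h1 := ENNReal.lintegral_mul_le_Lp_mul_Lq volume hPQ
      (f := fun t => k (x - t) ^ (1 / P) * g t) (g := fun t => k (x - t) ^ (1 / Q))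
      (((hkm x).pow_const _).mul hg).aemeasurable ((hkm x).pow_const _).aemeasurable
    have e1 : ∀ t, ((fun t => k (x - t) ^ (1 / P) * g t) * fun t => k (x - t) ^ (1 / Q)) t
        = k (x - t) * g t := by
      intro t
      have : k (x - t) ^ (1 / P) * k (x - t) ^ (1 / Q) = k (x - t) := by
        rw [← ENNReal.rpow_add_of_nonneg _ _ (by positivity) (by positivity), one_div, one_div,
          hPQ.inv_add_inv_eq_one, ENNReal.rpow_one]
      simp only [Pi.mul_apply]
      rw [mul_right_comm, this]
    have e2 : ∀ t, (k (x - t) ^ (1 / P) * g t) ^ P = k (x - t) * g t ^ P := by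
      intro t
      rw [ENNReal.mul_rpow_of_nonneg _ _ hP0.le, ← ENNReal.rpow_mul, one_div_mul_cancel hP0.ne',
        ENNReal.rpow_one]
    have e3 : ∀ t, (k (x - t) ^ (1 / Q)) ^ Q = k (x - t) := by
      intro t
      rw [← ENNReal.rpow_mul, one_div_mul_cancel hQ0.ne', ENNReal.rpow_one]
    simp only [e1, e2, e3, lintegral_sub_left_eq_self k x] at h1
    refine (ENNReal.rpow_le_rpow h1 hP0.le).trans (le_of_eq ?_)
    rw [ENNReal.mul_rpow_of_nonneg _ _ hP0.le, ← ENNReal.rpow_mul, ← ENNReal.rpow_mul,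
      one_div_mul_cancel hP0.ne', ENNReal.rpow_one, mul_comm, ← hA]
    congr 2
    rw [hQ, Real.conjExponent]
    have : P - 1 ≠ 0 := by linarith
    field_simp
  have hmeas : Measurable (Function.uncurry fun x t : ℝ => k (x - t) * g t ^ P) :=
    (hk.comp (measurable_fst.sub measurable_snd)).mul ((hg.comp measurable_snd).pow_const P)
  calc ∫⁻ x, (∫⁻ t, k (x - t) * g t) ^ P
      ≤ ∫⁻ x, A ^ (P - 1) * ∫⁻ t, k (x - t) * g t ^ P := lintegral_mono hpt
    _ = A ^ (P - 1) * ∫⁻ t, ∫⁻ x, k (x - t) * g t ^ P := by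
      rw [lintegral_const_mul _ hmeas.lintegral_prod_right, lintegral_lintegral_swap
        hmeas.aemeasurable]
    _ = A ^ (P - 1) * ∫⁻ t, A * g t ^ P := by
      congr 1
      refine lintegral_congr fun t => ?_
      have hkt : Measurable fun x => k (x - t) := hk.comp (measurable_sub_const t)
      rw [lintegral_mul_const _ hkt, lintegral_sub_right_eq_self k t]
    _ = A ^ P * ∫⁻ t, g t ^ P := by
      rw [lintegral_const_mul _ (hg.pow_const P), ← mul_assoc]
      congr 1
      nth_rewrite 2 [← ENNReal.rpow_one A]
      rw [← ENNReal.rpow_add_of_nonneg _ _ (by linarith) zero_le_one, sub_add_cancel]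

lemma integrable_exp_neg_mul_abs {c : ℝ} (hc : 0 < c) :
    Integrable fun s : ℝ => Real.exp (-(c * |s|)) := by
  refine Integrable.of_integral_ne_zero ?_
  rw [integral_comp_abs (f := fun s => Real.exp (-(c * s)))]
  simp_rw [← neg_mul]
  rw [integral_exp_mul_Ioi (neg_lt_zero.2 hc)]
  simp [ne_of_gt hc]

/-- `Lᵖ` bound for the integral operator with kernel dominated by
`M exp(-c|x-t|)`. -/
lemma eLpNorm_integral_kernel_le {p : ℝ≥0∞} (hp1 : 1 < p) (hp2 : p ≠ ⊤) {c : ℝ}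
    {K : ℝ → ℝ → ℝ} {M : ℝ} (hM : 0 ≤ M)
    (hKle : ∀ x t, |K x t| ≤ M * Real.exp (-(c * |x - t|))) {f : ℝ → ℝ} (hf : Measurable f) :
    eLpNorm (fun x => ∫⁻ t, ‖K x t * f t‖ₑ) p volume
      ≤ ENNReal.ofReal M * (∫⁻ s : ℝ, ENNReal.ofReal (Real.exp (-(c * |s|))))
        * eLpNorm f p volume := by
  have hP : 1 < p.toReal := by
    rw [← ENNReal.toReal_one]
    exact (ENNReal.toReal_lt_toReal ENNReal.one_ne_top hp2).2 hp1
  have hP0 : 0 < p.toReal := by linarith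
  have hp0 : p ≠ 0 := (zero_lt_one.trans hp1).ne'
  set k : ℝ → ℝ≥0∞ := fun s => ENNReal.ofReal (Real.exp (-(c * |s|))) with hk
  have hkm : Measurable k := by fun_prop
  have hle : ∀ x, ∫⁻ t, ‖K x t * f t‖ₑ ≤ ENNReal.ofReal M * ∫⁻ t, k (x - t) * ‖f t‖ₑ := by
    intro x
    rw [← lintegral_const_mul' _ _ ENNReal.ofReal_ne_top]
    refine lintegral_mono fun t => ?_
    rw [enorm_mul, ← mul_assoc]
    gcongr
    rw [Real.enorm_eq_ofReal_abs, ← ENNReal.ofReal_mul hM]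
    exact ENNReal.ofReal_le_ofReal (hKle x t)
  rw [eLpNorm_eq_lintegral_rpow_enorm_toReal hp0 hp2, eLpNorm_eq_lintegral_rpow_enorm_toReal hp0 hp2,
    one_div, ENNReal.rpow_inv_le_iff hP0, ENNReal.mul_rpow_of_nonneg _ _ hP0.le,
    ENNReal.mul_rpow_of_nonneg _ _ hP0.le, ENNReal.rpow_inv_rpow hP0.ne']
  calc ∫⁻ x, ‖∫⁻ t, ‖K x t * f t‖ₑ‖ₑ ^ p.toReal
      ≤ ∫⁻ x, ENNReal.ofReal M ^ p.toReal * (∫⁻ t, k (x - t) * ‖f t‖ₑ) ^ p.toReal := by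
        refine lintegral_mono fun x => ?_
        rw [← ENNReal.mul_rpow_of_nonneg _ _ hP0.le, enorm_eq_self]
        exact ENNReal.rpow_le_rpow (hle x) hP0.le
    _ ≤ ENNReal.ofReal M ^ p.toReal * ((∫⁻ s, k s) ^ p.toReal * ∫⁻ t, ‖f t‖ₑ ^ p.toReal) := by
        rw [lintegral_const_mul' _ _ (ENNReal.rpow_ne_top_of_nonneg hP0.le ENNReal.ofReal_ne_top)]
        gcongr
        exact lintegral_rpow_convolution_le hkm hf.enorm hP
    _ = _ := by rw [mul_assoc]

/-- Measurable kernels dominated by `M exp(-c|x-t|)` define bounded operators on `Lᵖ`, with norm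
at most a constant multiple of `M`. -/
lemma exists_clm_of_kernel_le (p : ℝ≥0∞) (hp1 : 1 < p) (hp2 : p ≠ ⊤) [Fact (1 ≤ p)]
    {c : ℝ} (hc : 0 < c) :
    ∃ A : ℝ, 0 ≤ A ∧ ∀ (K : ℝ → ℝ → ℝ) (M : ℝ), 0 ≤ M → Measurable (Function.uncurry K) →
      (∀ x t, |K x t| ≤ M * Real.exp (-(c * |x - t|))) →
      ∃ T : LpR p →L[ℝ] LpR p, ‖T‖ ≤ M * A ∧
        ∀ f : LpR p, (∀ᵐ x, Integrable fun t => K x t * f t) ∧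
          T f =ᵐ[volume] fun x => ∫ t, K x t * f t := by
  set I := ∫⁻ s : ℝ, ENNReal.ofReal (Real.exp (-(c * |s|))) with hI
  have hI_top : I ≠ ⊤ := (integrable_exp_neg_mul_abs hc).lintegral_lt_top.ne
  refine ⟨I.toReal, ENNReal.toReal_nonneg, fun K M hM hK hKle => ?_⟩
  have hfm : ∀ f : LpR p, Measurable f := fun f => (Lp.stronglyMeasurable f).measurable
  have hKf : ∀ f : LpR p, Measurable (Function.uncurry fun x t => K x t * f t) := fun f =>
    hK.mul ((hfm f).comp measurable_snd)
  have hbd : ∀ f : LpR p, eLpNorm (fun x => ∫⁻ t, ‖K x t * f t‖ₑ) p volume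
      ≤ ENNReal.ofReal M * I * eLpNorm f p volume := fun f =>
    eLpNorm_integral_kernel_le hp1 hp2 hM hKle (hfm f)
  have hbd_top : ∀ f : LpR p, ENNReal.ofReal M * I * eLpNorm f p volume ≠ ⊤ := fun f =>
    ENNReal.mul_ne_top (ENNReal.mul_ne_top ENNReal.ofReal_ne_top hI_top) (Lp.eLpNorm_ne_top f)
  have hint : ∀ f : LpR p, ∀ᵐ x, Integrable fun t => K x t * f t := by
    intro f
    have hmem : eLpNorm (fun x => ∫⁻ t, ‖K x t * f t‖ₑ) p volume < ⊤ :=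
      (hbd f).trans_lt (hbd_top f).lt_top
    rw [eLpNorm_lt_top_iff_lintegral_rpow_enorm_lt_top (zero_lt_one.trans hp1).ne' hp2] at hmem
    have hm : Measurable fun x => ∫⁻ t, ‖K x t * f t‖ₑ :=
      (hKf f).enorm.lintegral_prod_right
    filter_upwards [ae_lt_top (hm.enorm.pow_const _) hmem.ne] with x hx
    refine ⟨((hKf f).comp measurable_prodMk_left).aestronglyMeasurable, ?_⟩
    rw [hasFiniteIntegral_iff_enorm]
    rw [enorm_eq_self] at hx
    exact (ENNReal.rpow_lt_top_iff_of_pos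
      (ENNReal.toReal_pos (zero_lt_one.trans hp1).ne' hp2)).1 hx
  have hnorm : ∀ f : LpR p, eLpNorm (fun x => ∫ t, K x t * f t) p volume
      ≤ ENNReal.ofReal M * I * eLpNorm f p volume := fun f =>
    (eLpNorm_mono_enorm fun x => enorm_integral_le_lintegral_enorm _).trans (hbd f)
  have hmem : ∀ f : LpR p, MemLp (fun x => ∫ t, K x t * f t) p volume := fun f =>
    ⟨(hKf f).stronglyMeasurable.integral_prod_right.aestronglyMeasurable,
      (hnorm f).trans_lt (hbd_top f).lt_top⟩
  let L : LpR p →ₗ[ℝ] LpR p :=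
    { toFun := fun f => (hmem f).toLp _
      map_add' := fun f g => by
        refine Lp.ext ?_
        filter_upwards [(hmem (f + g)).coeFn_toLp, Lp.coeFn_add ((hmem f).toLp _) ((hmem g).toLp _),
          (hmem f).coeFn_toLp, (hmem g).coeFn_toLp, hint f, hint g] with x h1 h2 h3 h4 h5 h6
        rw [h1, h2, Pi.add_apply, h3, h4, ← integral_add h5 h6]
        refine integral_congr_ae ?_
        filter_upwards [Lp.coeFn_add f g] with t ht
        rw [ht, Pi.add_apply, mul_add]
      map_smul' := fun a f => by
        refine Lp.ext ?_
        filter_upwards [(hmem (a • f)).coeFn_toLp, Lp.coeFn_smul a ((hmem f).toLp _),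
          (hmem f).coeFn_toLp] with x h1 h2 h3
        rw [h1, RingHom.id_apply, h2, Pi.smul_apply, h3, smul_eq_mul, ← integral_const_mul]
        refine integral_congr_ae ?_
        filter_upwards [Lp.coeFn_smul a f] with t ht
        rw [ht, Pi.smul_apply, smul_eq_mul, mul_left_comm] }
  have hL : ∀ f, ‖L f‖ ≤ M * I.toReal * ‖f‖ := by
    intro f
    change ‖(hmem f).toLp _‖ ≤ _
    have h := ENNReal.toReal_mono (hbd_top f) (hnorm f)
    rwa [ENNReal.toReal_mul, ENNReal.toReal_mul, ENNReal.toReal_ofReal hM, ← Lp.norm_def,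
      ← Lp.norm_toLp _ (hmem f)] at h
  exact ⟨L.mkContinuous _ hL, L.mkContinuous_norm_le (by positivity) hL, fun f =>
    ⟨hint f, (hmem f).coeFn_toLp⟩⟩

lemma isCompactOperator_of_forall_mem_finiteDimensional {E F : Type*} [NormedAddCommGroup E]
    [NormedSpace ℝ E] [NormedAddCommGroup F] [NormedSpace ℝ F] (T : E →L[ℝ] F)
    (V : Submodule ℝ F) [FiniteDimensional ℝ V] (hT : ∀ x, T x ∈ V) : IsCompactOperator T := by
  have : ProperSpace V := FiniteDimensional.proper ℝ V
  exact ((isCompactOperator_id (E := V)).comp_clm (T.codRestrict V hT)).clm_comp V.subtypeL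

/-- An operator whose values are step functions over a fixed finite family of sets is compact. -/
lemma isCompactOperator_of_ae_eq_sum_indicator {p : ℝ≥0∞} [Fact (1 ≤ p)] {ι : Type*}
    (T : LpR p →L[ℝ] LpR p) (S : Finset ι) (I : ι → Set ℝ) (hI : ∀ k, MeasurableSet (I k))
    (hI' : ∀ k, volume (I k) ≠ ⊤) (a : LpR p → ι → ℝ)
    (hT : ∀ f, T f =ᵐ[volume] fun x => ∑ k ∈ S, (I k).indicator (fun _ => a f k) x) :
    IsCompactOperator T := by
  let e : ι → LpR p := fun k => indicatorConstLp p (hI k) (hI' k) (1 : ℝ)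
  have hfin : FiniteDimensional ℝ (Submodule.span ℝ (e '' (S : Set ι))) :=
    FiniteDimensional.span_of_finite ℝ (S.finite_toSet.image e)
  refine isCompactOperator_of_forall_mem_finiteDimensional T
    (Submodule.span ℝ (e '' (S : Set ι))) fun f => ?_
  have hsum : T f = ∑ k ∈ S, a f k • e k := by
    refine Lp.ext ((hT f).trans ?_)
    have h1 : ∀ k ∈ S, ∀ᵐ x, (a f k • e k : LpR p) x = (I k).indicator (fun _ => a f k) x := by
      intro k _
      filter_upwards [Lp.coeFn_smul (a f k) (e k),
        indicatorConstLp_coeFn (p := p) (hs := hI k) (hμs := hI' k) (c := (1 : ℝ))] with x hx1 hx2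
      rw [hx1, Pi.smul_apply, hx2, smul_eq_mul]
      by_cases hx : x ∈ I k <;> simp [hx]
    filter_upwards [(ae_ball_iff S.countable_toSet).2 h1,
      Lp.coeFn_finsetSum S fun k => a f k • e k] with x hx1 hx2
    rw [hx2, Finset.sum_apply]
    exact Finset.sum_congr rfl fun k hk => (hx1 k hk).symm
  rw [hsum]
  exact Submodule.sum_mem _ fun k hk => Submodule.smul_mem _ _
    (Submodule.subset_span (Set.mem_image_of_mem e hk))

lemma measurable_uncurry_greenKernel {u v : ℝ → ℝ} (hu : Continuous u) (hv : Continuous v) :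
    Measurable (Function.uncurry (greenKernel u v)) := by
  have hu := hu.measurable
  have hv := hv.measurable
  exact Measurable.ite (measurableSet_le measurable_snd measurable_fst)
    ((hu.comp measurable_fst).mul (hv.comp measurable_snd))
    ((hu.comp measurable_snd).mul (hv.comp measurable_fst))

/-- Relative continuity of the Green kernel in its first argument, uniform in the second. -/
lemma PFSS.abs_greenKernel_sub_le {r q u v u' v' : ℝ → ℝ} (H : PFSS r q u v u' v') {x y η : ℝ}
    (hyx : y ≤ x) (huη : u y - u x ≤ η * u x) (hvη : v x - v y ≤ η * v x) (t : ℝ) :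
    |greenKernel u v x t - greenKernel u v y t| ≤ η * greenKernel u v x t := by
  have hu := H.u_pos
  have hv := H.v_pos
  have huyx := H.antitone_u hyx
  have hvyx := H.monotone_v hyx
  have hη : 0 ≤ η := by
    by_contra hη
    nlinarith [hu x]
  rw [abs_le]
  rcases le_or_gt t y with hty | hty
  · simp only [greenKernel, hty, hty.trans hyx, if_true]
    constructor <;> nlinarith [hv t, hu x, mul_nonneg hη (mul_pos (hu x) (hv t)).le]
  rcases le_or_gt t x with htx | htx
  · simp only [greenKernel, not_le.2 hty, htx, if_true, if_false]
    have h1 := H.antitone_u hty.le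
    have h2 := H.antitone_u htx
    have h3 := H.monotone_v hty.le
    have h4 := H.monotone_v htx
    have h5 : (1 - η) * v t ≤ v y := by
      rcases le_total η 1 with h | h
      · nlinarith
      · nlinarith [hv t, hv y]
    have h6 := mul_le_mul (h1.trans (by linarith : u y ≤ (1 + η) * u x)) h3 (hv y).le
      (mul_nonneg (by linarith) (hu x).le)
    have h7 := mul_le_mul_of_nonneg_left h5 (hu x).le
    have h8 := mul_le_mul_of_nonneg_right h2 (hv y).le
    constructor <;> linarith
  · simp only [greenKernel, not_le.2 hty, not_le.2 htx, if_false]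
    constructor <;> nlinarith [hu t, hv x, mul_nonneg hη (mul_pos (hu t) (hv x)).le]

/-- The kernel `K`, with its first argument rounded down to `m⁻¹ ℤ`, and cut off outside the cells
with index in `S`. -/
def stepKernel (K : ℝ → ℝ → ℝ) (m : ℕ) (S : Finset ℤ) (x t : ℝ) : ℝ :=
  if ⌊x * m⌋ ∈ S then K (⌊x * m⌋ / m) t else 0

lemma measurable_uncurry_stepKernel {K : ℝ → ℝ → ℝ} (hK : Measurable (Function.uncurry K))
    (m : ℕ) (S : Finset ℤ) : Measurable (Function.uncurry (stepKernel K m S)) := by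
  have hfloor : Measurable fun z : ℝ × ℝ => ⌊z.1 * m⌋ :=
    (measurable_fst.mul_const _).floor
  refine Measurable.ite (hfloor (MeasurableSet.of_discrete (s := (S : Set ℤ)))) ?_
    measurable_const
  have hcast : Measurable fun k : ℤ => (k : ℝ) := measurable_from_top
  exact hK.comp (((hcast.comp hfloor).div_const _).prodMk measurable_snd)

lemma isCompactOperator_of_stepKernel {p : ℝ≥0∞} [Fact (1 ≤ p)] (T : LpR p →L[ℝ] LpR p)
    (K : ℝ → ℝ → ℝ) {m : ℕ} (hm : 0 < m) (S : Finset ℤ)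
    (hT : ∀ f : LpR p, T f =ᵐ[volume] fun x => ∫ t, stepKernel K m S x t * f t) :
    IsCompactOperator T := by
  have hm' : (0 : ℝ) < m := Nat.cast_pos.2 hm
  refine isCompactOperator_of_ae_eq_sum_indicator T S (fun k : ℤ => {x : ℝ | ⌊x * m⌋ = k})
    (fun k => (measurable_id.mul_const (m : ℝ)).floor (measurableSet_singleton k)) (fun k => ?_)
    (fun f k => ∫ t, K (k / m) t * f t) fun f => (hT f).trans (Eventually.of_forall fun x => ?_)
  · refine ((measure_mono (t := Set.Icc ((k : ℝ) / m) ((k + 1) / m)) fun x hx => ?_).trans_lt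
      measure_Icc_lt_top).ne
    obtain ⟨h1, h2⟩ := Int.floor_eq_iff.1 hx
    exact ⟨(div_le_iff₀ hm').2 h1, (le_div_iff₀ hm').2 h2.le⟩
  · simp only [stepKernel, Set.indicator_apply, Set.mem_ofPred_eq, Finset.sum_ite_eq]
    split_ifs <;> simp

/-- If `u v → 0` at infinity, the Green kernel is approximated by step kernels, uniformly relative
to an exponential weight. -/
lemma PFSS.exists_stepKernel_approx {r q u v u' v' : ℝ → ℝ} (H : PFSS r q u v u' v')
    (hr : ∀ x, 0 < r x) {R B : ℝ} (hR : ∀ x, r x ≤ R) (hB : ∀ x, u x * v x ≤ B)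
    (h0 : Tendsto (fun x => u x * v x) (cocompact ℝ) (𝓝 0)) {ε : ℝ} (hε : 0 < ε) :
    ∃ (m : ℕ) (S : Finset ℤ), 0 < m ∧ ∀ x t,
      |greenKernel u v x t - stepKernel (greenKernel u v) m S x t|
        ≤ ε * Real.exp (-((2 * (R * B))⁻¹ * |x - t|)) := by
  have hB0 : 0 < B := (mul_pos (H.u_pos 0) (H.v_pos 0)).trans_le (hB 0)
  have htail : ∀ᶠ x in cocompact ℝ, u x * v x < ε ^ 2 / B :=
    h0.eventually_lt_const (by positivity)
  obtain ⟨ρ, hρ⟩ := Metric.closedBall_compl_subset_of_mem_cocompact htail 0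
  obtain ⟨N, hN⟩ := exists_nat_gt ρ
  set η := ε / B with hη
  have hη0 : 0 < η := by positivity
  have hcpt : IsCompact (Set.Icc (-(N : ℝ)) N) := isCompact_Icc
  obtain ⟨δ₁, hδ₁, hu⟩ := Metric.uniformContinuousOn_iff.1
    (hcpt.uniformContinuousOn_of_continuous H.continuous_u.continuousOn) (η * u N)
    (mul_pos hη0 (H.u_pos _))
  obtain ⟨δ₂, hδ₂, hv⟩ := Metric.uniformContinuousOn_iff.1
    (hcpt.uniformContinuousOn_of_continuous H.continuous_v.continuousOn) (η * v (-N))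
    (mul_pos hη0 (H.v_pos _))
  obtain ⟨n, hn⟩ := exists_nat_one_div_lt (lt_min hδ₁ hδ₂)
  obtain ⟨hn1, hn2⟩ := lt_min_iff.1 hn
  refine ⟨n + 1, Finset.Ico (-(N * (n + 1) : ℤ)) (N * (n + 1)), n.succ_pos, fun x t => ?_⟩
  have hm : (0 : ℝ) < ((n + 1 : ℕ) : ℝ) := Nat.cast_pos.2 n.succ_pos
  by_cases hx : ⌊x * (n + 1 : ℕ)⌋ ∈ Finset.Ico (-(N * (n + 1) : ℤ)) (N * (n + 1))
  · set y : ℝ := ⌊x * (n + 1 : ℕ)⌋ / (n + 1 : ℕ) with hy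
    have hyx : y ≤ x := (div_le_iff₀ hm).2 (Int.floor_le _)
    have hxy : x - y < 1 / (n + 1 : ℝ) := by
      have h1 : x < (⌊x * (n + 1 : ℕ)⌋ + 1) / (n + 1 : ℕ) := (lt_div_iff₀ hm).2
        (Int.lt_floor_add_one _)
      rw [add_div, ← hy] at h1
      push_cast at h1
      linarith
    obtain ⟨hx1, hx2⟩ := Finset.mem_Ico.1 hx
    have hNy : -(N : ℝ) ≤ y := by
      rw [hy, le_div_iff₀ hm]
      have : ((-(N * (n + 1) : ℤ) : ℤ) : ℝ) ≤ ⌊x * (n + 1 : ℕ)⌋ := Int.cast_le.2 hx1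
      push_cast at this ⊢
      linarith
    have hxN : x ≤ N := by
      have := Int.floor_lt.1 hx2
      push_cast at this
      refine le_of_mul_le_mul_right this.le (by positivity)
    have hxm : x ∈ Set.Icc (-(N : ℝ)) N := ⟨hNy.trans hyx, hxN⟩
    have hym : y ∈ Set.Icc (-(N : ℝ)) N := ⟨hNy, hyx.trans hxN⟩
    have hdist : dist x y < 1 / (n + 1 : ℝ) := by
      rwa [Real.dist_eq, abs_of_nonneg (sub_nonneg.2 hyx)]
    have hu1 := hu y hym x hxm (by rw [dist_comm]; exact hdist.trans hn1)
    have hv1 := hv x hxm y hym (hdist.trans hn2)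
    rw [Real.dist_eq] at hu1 hv1
    have hstep : stepKernel (greenKernel u v) (n + 1)
        (Finset.Ico (-(N * (n + 1) : ℤ)) (N * (n + 1))) x t = greenKernel u v y t := by
      rw [stepKernel, if_pos hx]
    rw [hstep]
    have h2 := H.abs_greenKernel_sub_le (η := η) hyx
      ((le_abs_self _).trans (hu1.le.trans
        (mul_le_mul_of_nonneg_left (H.antitone_u hxN) hη0.le)))
      ((le_abs_self _).trans (hv1.le.trans
        (mul_le_mul_of_nonneg_left (H.monotone_v hxm.1) hη0.le))) t
    have h3 := H.greenKernel_le hr hR hB hB0.le (x := x)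
      (by rw [sq]; exact mul_le_mul_of_nonneg_right (hB x) hB0.le) t
    refine (h2.trans (mul_le_mul_of_nonneg_left h3 hη0.le)).trans (le_of_eq ?_)
    rw [← mul_assoc, hη, div_mul_cancel₀ _ hB0.ne']
  · rw [stepKernel, if_neg hx, sub_zero, abs_of_pos (H.greenKernel_pos x t)]
    refine H.greenKernel_le hr hR hB hε.le ?_ t
    rw [← le_div_iff₀ hB0]
    refine (hρ ?_).le
    rw [Set.mem_compl_iff, Metric.mem_closedBall, dist_zero_right, Real.norm_eq_abs, not_le]
    refine hN.trans_le ?_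
    by_contra hlt
    obtain ⟨h1, h2⟩ := abs_lt.1 (not_le.1 hlt)
    refine hx (Finset.mem_Ico.2 ⟨Int.le_floor.2 ?_, Int.floor_lt.2 ?_⟩)
    · push_cast at hm ⊢
      nlinarith
    · push_cast at hm ⊢
      nlinarith

/-- **Corollary 3.11.** Assume (1.2), (1.3), let `u, v` be a principal FSS and
suppose `r₀ = sup r < ∞`.  If `h₀ = sup h < ∞` then for every `p ∈ (1,∞)` the
Green operator is bounded on `L_p(ℝ)`; if moreover `h(x) → 0` as `|x| → ∞`,
then it is compact. -/
theorem green_bounded_compact_of_r_bounded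
    (r q u v u' v' d₁ d₂ : ℝ → ℝ) (p : ℝ≥0∞) (hp1 : 1 < p) (hp2 : p ≠ ⊤)
    [Fact (1 ≤ p)]
    (h12 : Cond12 r q) (h13 : Cond13 r q) (hfss : PFSS r q u v u' v')
    (hd₁ : IsD1 r q d₁) (hd₂ : IsD2 r q d₂)
    (hr₀ : BddAbove (Set.range r)) :
    (BddAbove (Set.range (hF r d₁ d₂)) →
      ∃ G : LpR p →L[ℝ] LpR p, IsGreenOp u v p G) ∧
    (BddAbove (Set.range (hF r d₁ d₂)) →
      Tendsto (hF r d₁ d₂) (cocompact ℝ) (𝓝 0) →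
      ∃ G : LpR p →L[ℝ] LpR p, IsGreenOp u v p G ∧ IsCompactOperator G) := by
  rw [← forall_and]
  intro hh₀
  obtain ⟨R, hR⟩ := hr₀
  obtain ⟨h₀, hh₀⟩ := hh₀
  replace hR : ∀ x, r x ≤ R := fun x => hR ⟨x, rfl⟩
  have hr : ∀ x, 0 < r x := h12.2.2.1
  have hρ := hfss.u_mul_v_le h12 hd₁ hd₂
  have hB : ∀ x, u x * v x ≤ 2 * h₀ := fun x => (hρ x).trans (by linarith [hh₀ ⟨x, rfl⟩])
  set B := 2 * h₀
  have hR0 : 0 < R := (hr 0).trans_le (hR 0)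
  have hB0 : 0 < B := (mul_pos (hfss.u_pos 0) (hfss.v_pos 0)).trans_le (hB 0)
  have hc : 0 < (2 * (R * B))⁻¹ := by positivity
  obtain ⟨A, hA0, hA⟩ := exists_clm_of_kernel_le p hp1 hp2 hc
  have hGmeas := measurable_uncurry_greenKernel hfss.continuous_u hfss.continuous_v
  have hGle : ∀ x t, |greenKernel u v x t|
      ≤ B * Real.exp (-((2 * (R * B))⁻¹ * |x - t|)) := fun x t => by
    rw [abs_of_pos (hfss.greenKernel_pos x t)]
    exact hfss.greenKernel_le hr hR hB hB0.le
      (by rw [sq]; exact mul_le_mul_of_nonneg_right (hB x) hB0.le) t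
  obtain ⟨G, -, hG⟩ := hA (greenKernel u v) B hB0.le hGmeas hGle
  refine ⟨⟨G, fun f => (hG f).2⟩, fun hlim => ⟨G, fun f => (hG f).2, ?_⟩⟩
  have hlim' : Tendsto (fun x => u x * v x) (cocompact ℝ) (𝓝 0) :=
    squeeze_zero (fun x => (mul_pos (hfss.u_pos x) (hfss.v_pos x)).le) hρ
      (by simpa using hlim.const_mul 2)
  have hclosed : IsClosed {T : LpR p →L[ℝ] LpR p | IsCompactOperator T} :=
    isClosed_setOfPred_isCompactOperator
  refine hclosed.closure_subset (Metric.mem_closure_iff.2 fun ε hε => ?_)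
  have hε' : 0 < ε / (A + 1) := by positivity
  obtain ⟨m, S, hm, hS⟩ := hfss.exists_stepKernel_approx hr hR hB hlim' hε'
  have hSmeas := measurable_uncurry_stepKernel hGmeas m S
  obtain ⟨T, -, hT⟩ := hA (stepKernel (greenKernel u v) m S) (B + ε / (A + 1)) (by positivity)
    hSmeas fun x t => by
      have h1 := abs_sub_abs_le_abs_sub (stepKernel (greenKernel u v) m S x t)
        (greenKernel u v x t)
      rw [abs_sub_comm] at h1
      linarith [hS x t, hGle x t]
  obtain ⟨D, hDnorm, hD⟩ := hA (fun x t => greenKernel u v x t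
    - stepKernel (greenKernel u v) m S x t) _ hε'.le (hGmeas.sub hSmeas) hS
  refine ⟨T, isCompactOperator_of_stepKernel T _ hm S fun f => (hT f).2, ?_⟩
  have hGT : G - T = D := by
    ext1 f
    refine Lp.ext ?_
    filter_upwards [(hG f).1, (hG f).2, (hT f).1, (hT f).2, (hD f).2,
      Lp.coeFn_sub (G f) (T f)] with x h1 h2 h3 h4 h5 h6
    rw [sub_apply, h6, Pi.sub_apply, h2, h4, h5, ← integral_sub h1 h3]
    simp only [sub_mul]
  rw [dist_eq_norm, hGT]
  refine hDnorm.trans_lt ?_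
  rw [div_mul_eq_mul_div, div_lt_iff₀ (by positivity)]
  nlinarith
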